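/- arXiv:math/0410218 — 5 statements merged into one kernel-verified Lean document; each statement's English description precedes it below -/
import Mathlib

section
/- Let r ≥ 2 and n ≥ r be integers, and let G be a simple graph with n vertices and m edges, where m ≥ t_r(n). Then every 𝔓-sequence v_1, …, v_r of r terms in G satisfies Σ_{i=1}^{r} d(v_i) ≥ (r−1)·n. -/
open Finset

/-- The number of edges of a simple graph. -/
noncomputable def edgeCount {V : Type*} (G : SimpleGraph V) : ℕ := Nat.card G.edgeSet

/-- The degree of a vertex. -/
noncomputable def deg {V : Type*} (G : SimpleGraph V) (u : V) : ℕ := Nat.card (G.neighborSet u)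

/-- The number of edges `t_r(n)` of the Turán graph `T_r(n)`. -/
noncomputable def turanEdges (r n : ℕ) : ℕ := edgeCount (SimpleGraph.turanGraph n r)

/-- `v 0, ..., v (k-1)` is a 𝔓-sequence in `G`: each `v i` lies in the common
neighbourhood of the previous terms and has maximum degree among the vertices of
that common neighbourhood (for `i = 0`, the common neighbourhood is the whole
vertex set, so `v 0` is a vertex of maximum degree in `G`). -/
def IsPSeq {V : Type*} (G : SimpleGraph V) {k : ℕ} (v : Fin k → V) : Prop :=
  ∀ i : Fin k,
    (∀ j : Fin k, j < i → G.Adj (v j) (v i)) ∧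
    ∀ u : V, (∀ j : Fin k, j < i → G.Adj (v j) u) → deg G u ≤ deg G (v i)

theorem edgeCount_eq_card_edgeFinset {V : Type*} (G : SimpleGraph V) [Fintype G.edgeSet] :
    edgeCount G = #G.edgeFinset := by
  rw [edgeCount, Nat.card_eq_fintype_card, SimpleGraph.edgeFinset_card]

theorem deg_eq_degree {V : Type*} (G : SimpleGraph V) (u : V) [Fintype (G.neighborSet u)] :
    deg G u = G.degree u := by
  rw [deg, Nat.card_eq_fintype_card, SimpleGraph.card_neighborSet_eq_degree]

/-- A complete multipartite graph on `n` vertices with `r` parts has at most `t_r(n)` edges. -/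
theorem sum_mul_sub_le_turanEdges {r n : ℕ} (k : Fin r → ℕ) (hk : ∑ i, k i = n) :
    ∑ i, k i * (n - k i) ≤ 2 * turanEdges r n := by
  classical
  set H := SimpleGraph.completeMultipartiteGraph (fun i => Fin (k i)) with hH
  have hcard : Fintype.card (Σ i, Fin (k i)) = n := by simp [hk]
  have hfree : H.CliqueFree (r + 1) :=
    SimpleGraph.cliqueFree_completeMultipartiteGraph _ (by simp)
  have hle : #H.edgeFinset ≤ turanEdges r n := by
    rw [turanEdges, edgeCount_eq_card_edgeFinset, SimpleGraph.card_edgeFinset_turanGraph, ← hcard]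
    exact hfree.card_edgeFinset_le
  have hdeg (x : Σ i, Fin (k i)) : H.degree x = n - k x.1 := by
    have hpart : (univ.filter fun y : Σ i, Fin (k i) => y.1 = x.1) =
        univ.map (Function.Embedding.sigmaMk x.1) := by
      ext ⟨i, y⟩
      simp only [mem_filter_univ, mem_map, mem_univ, true_and, Function.Embedding.sigmaMk_apply]
      constructor
      · rintro rfl
        exact ⟨y, rfl⟩
      · rintro ⟨z, hz⟩
        exact (congrArg Sigma.fst hz).symm
    have hnbr : H.neighborFinset x = (univ.filter fun y : Σ i, Fin (k i) => y.1 = x.1)ᶜ := by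
      ext y
      simp [hH, eq_comm]
    rw [← SimpleGraph.card_neighborFinset_eq_degree, hnbr, hpart, card_compl, card_map, card_univ,
      Fintype.card_fin, hcard]
  have hsum := H.sum_degrees_eq_twice_card_edges
  simp only [hdeg, Fintype.sum_sigma, sum_const, card_univ, Fintype.card_fin, smul_eq_mul] at hsum
  omega

/-- Shifting weight from the least entry `d l` to entries with slack `k i + d i < n` does not
decrease `∑ i, k i * d i`; once `k l + d l < n`, the sum is compared termwise. -/
theorem exists_sum_mul_lt_sum_mul_sub {ι : Type*} [Fintype ι] {n : ℕ} {d : ι → ℕ} {l : ι}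
    (hd : ∀ i, d l ≤ d i) (hdl : d l + 2 ≤ n) (hlt : ∑ i, d i + n < Fintype.card ι * n)
    (k : ι → ℕ) (hk : ∀ i ≠ l, k i + d i ≤ n) (hl : 1 ≤ k l) (hsum : ∑ i, k i = n) :
    ∃ k' : ι → ℕ, ∑ i, k' i = n ∧ ∑ i, k i * d i < ∑ i, k' i * (n - k' i) := by
  classical
  induction h : k l generalizing k with
  | zero => omega
  | succ K ih =>
    by_cases hK : k l + d l < n
    · refine ⟨k, hsum, sum_lt_sum (fun i _ => ?_) ⟨l, mem_univ l, ?_⟩⟩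
      · refine Nat.mul_le_mul_left _ ?_
        rcases eq_or_ne i l with rfl | hi
        · omega
        · have := hk i hi
          omega
      · exact Nat.mul_lt_mul_of_pos_left (by omega) hl
    · obtain ⟨i, hil, hi⟩ : ∃ i ≠ l, k i + d i < n := by
        by_contra! hge
        have : ∑ _i : ι, n ≤ ∑ i, (k i + d i) := sum_le_sum fun i _ => by
          rcases eq_or_ne i l with rfl | hi
          · omega
          · exact hge i hi
        rw [sum_add_distrib, hsum, sum_const, card_univ, smul_eq_mul] at this
        omega
      have split (f : ι → ℕ) : ∑ j, f j = f i + (f l + ∑ j ∈ (univ.erase i).erase l, f j) := by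
        rw [add_sum_erase _ _ (mem_erase.2 ⟨hil.symm, mem_univ l⟩), add_sum_erase _ _ (mem_univ i)]
      have hrest (f g : ι → ℕ) (hfg : ∀ j, j ≠ i → j ≠ l → f j = g j) :
          ∑ j ∈ (univ.erase i).erase l, f j = ∑ j ∈ (univ.erase i).erase l, g j :=
        sum_congr rfl fun j hj =>
          hfg j (ne_of_mem_erase (mem_of_mem_erase hj)) (ne_of_mem_erase hj)
      set k₁ := Function.update (Function.update k l K) i (k i + 1) with hk₁
      have h₁i : k₁ i = k i + 1 := by simp [hk₁]
      have h₁l : k₁ l = K := by simp [hk₁, hil.symm]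
      have h₁ (j) (hji : j ≠ i) (hjl : j ≠ l) : k₁ j = k j := by simp [hk₁, hji, hjl]
      obtain ⟨k', hk', hlt'⟩ := ih k₁ (fun j hj => by
          rcases eq_or_ne j i with rfl | hji
          · omega
          · rw [h₁ j hji hj]
            exact hk j hj) (by omega) (by
          rw [split] at hsum ⊢
          rw [h₁i, h₁l, hrest k₁ k h₁]
          omega) h₁l
      refine ⟨k', hk', lt_of_le_of_lt ?_ hlt'⟩
      rw [split, split (fun j => k₁ j * d j), h₁i, h₁l, h,
        hrest (fun j => k₁ j * d j) (fun j => k j * d j) fun j hji hjl => by rw [h₁ j hji hjl]]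
      have := hd i
      nlinarith

/-- If r ≥ 2, n ≥ r, and G is a graph with n vertices and m ≥ t_r(n)
edges, then every 𝔓-sequence of r terms has degree sum at least (r−1)·n. -/
theorem pseq_degree_sum_ge (r n m : ℕ) (hr : 2 ≤ r) (hn : r ≤ n)
    (G : SimpleGraph (Fin n)) (hm : edgeCount G = m) (hmt : turanEdges r n ≤ m)
    (v : Fin r → Fin n) (hP : IsPSeq G v) :
    (r - 1) * n ≤ ∑ i, deg G (v i) := by
  classical
  obtain ⟨s, rfl⟩ : ∃ s, r = s + 1 := ⟨r - 1, by omega⟩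
  set l := Fin.last s
  have hd (i) : deg G (v l) ≤ deg G (v i) :=
    (hP i).2 _ fun j hj => (hP l).1 j (hj.trans_le (Fin.le_last i))
  rw [Nat.add_sub_cancel]
  by_contra! hlt
  have hdl : deg G (v l) + 2 ≤ n := by
    by_contra! h
    have : ∑ _i : Fin (s + 1), (n - 1) ≤ ∑ i, deg G (v i) :=
      sum_le_sum fun i _ => by have := hd i; omega
    rw [sum_const, card_univ, Fintype.card_fin, smul_eq_mul] at this
    obtain ⟨n, rfl⟩ : ∃ n', n = n' + 1 := ⟨n - 1, by omega⟩
    rw [Nat.add_sub_cancel] at this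
    nlinarith
  have hp (u : Fin n) : ∃ i, (∀ j < i, G.Adj (v j) u) ∧ (i ≠ l → ¬ G.Adj (v i) u) := by
    obtain ⟨i, hi, hmin⟩ := WellFounded.has_min (wellFounded_lt (α := Fin (s + 1)))
      {i | i = l ∨ ¬ G.Adj (v i) u} ⟨l, Or.inl rfl⟩
    refine ⟨i, fun j hj => ?_, hi.resolve_left⟩
    by_contra h
    exact hmin j (Or.inr h) hj
  choose p hp₁ hp₂ using hp
  have hfiber (i) (hi : i ≠ l) : #{u | p u = i} + deg G (v i) ≤ n := by
    have hdisj : Disjoint (univ.filter fun u => p u = i) (G.neighborFinset (v i)) := by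
      rw [disjoint_left]
      intro u hu hadj
      obtain rfl : p u = i := by simpa using hu
      exact hp₂ u hi (by simpa using hadj)
    rw [deg_eq_degree, ← SimpleGraph.card_neighborFinset_eq_degree, ← card_union_of_disjoint hdisj]
    exact (card_le_univ _).trans_eq (Fintype.card_fin n)
  have hlast : 1 ≤ #{u | p u = l} := by
    refine card_pos.2 ⟨v l, ?_⟩
    rw [mem_filter_univ]
    by_contra h
    exact hp₂ _ h ((hP l).1 _ (lt_of_le_of_ne (Fin.le_last _) h))
  have hsum : ∑ i, #{u | p u = i} = n := by
    rw [← card_eq_sum_card_fiberwise fun u _ => mem_coe.2 (mem_univ (p u)), card_univ,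
      Fintype.card_fin]
  obtain ⟨k, hk, hkm⟩ := exists_sum_mul_lt_sum_mul_sub (d := fun i => deg G (v i)) hd hdl
    (by rw [Fintype.card_fin]; linarith) (fun i => #{u | p u = i}) hfiber hlast hsum
  have hedges : 2 * m ≤ ∑ i, #{u | p u = i} * deg G (v i) := by
    rw [← hm, edgeCount_eq_card_edgeFinset, ← G.sum_degrees_eq_twice_card_edges]
    calc ∑ u, G.degree u ≤ ∑ u, deg G (v (p u)) := sum_le_sum fun u _ => by
          rw [← deg_eq_degree]
          exact (hP (p u)).2 u (hp₁ u)
      _ = ∑ i, #{u | p u = i} * deg G (v i) := by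
          rw [← sum_fiberwise univ p]
          refine sum_congr rfl fun i _ => ?_
          rw [sum_congr rfl fun u hu => by rw [(mem_filter_univ u).1 hu], sum_const, smul_eq_mul]
  have := sum_mul_sub_le_turanEdges k hk
  omega
end

section
/- Let r ≥ 2 and n ≥ r be integers, and let G be a simple graph with n vertices and m edges, where m ≥ t_r(n). If some 𝔓-sequence v_1, …, v_r of r terms in G satisfies Σ_{i=1}^{r} d(v_i) = (r−1)·n, then m = t_r(n). -/
open Finset

theorem sum_deg_eq_two_mul_edgeCount {V : Type*} [Fintype V] (G : SimpleGraph V) :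
    ∑ u, deg G u = 2 * edgeCount G := by
  classical
  simp_rw [edgeCount_eq_card_edgeFinset, deg_eq_degree]
  exact G.sum_degrees_eq_twice_card_edges

/-- A complete multipartite graph with `r` parts has at most as many edges as the Turán graph. -/
theorem sum_mul_sub_le_two_mul_turanEdges {r n : ℕ} (hr : 0 < r) (k : Fin r → ℕ)
    (hk : ∑ i, k i = n) : ∑ i, k i * (n - k i) ≤ 2 * turanEdges r n := by
  classical
  have e : Fin n ≃ Σ i : Fin r, Fin (k i) := Fintype.equivOfCardEq (by simp [hk])
  let c : Fin n → Fin r := fun u => (e u).1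
  have hfib (i : Fin r) : #{u | c u = i} = k i := by
    rw [← Fintype.card_subtype, ← Fintype.card_fin (k i)]
    exact Fintype.card_congr ((e.subtypeEquiv fun _ => Iff.rfl).trans
      (Equiv.sigmaSubtype i))
  let H : SimpleGraph (Fin n) := (⊤ : SimpleGraph (Fin r)).comap c
  have hadj (u w : Fin n) : H.Adj u w ↔ c u ≠ c w := by simp [H]
  have hcol : H.Colorable r := ⟨SimpleGraph.Coloring.mk c fun h => (hadj _ _).1 h⟩
  have hle : edgeCount H ≤ turanEdges r n := by
    rw [turanEdges, edgeCount_eq_card_edgeFinset, edgeCount_eq_card_edgeFinset]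
    exact (SimpleGraph.isTuranMaximal_turanGraph hr).2 (hcol.cliqueFree (Nat.lt_succ_self r))
  have hdeg (u : Fin n) : deg H u = n - k (c u) := by
    have h : H.neighborFinset u = ({w | c w = c u} : Finset (Fin n))ᶜ := by
      ext w
      simp [hadj, eq_comm]
    rw [deg_eq_degree, ← SimpleGraph.card_neighborFinset_eq_degree, h, card_compl, hfib,
      Fintype.card_fin]
  calc ∑ i, k i * (n - k i) = ∑ i, ∑ u with c u = i, deg H u := by
        refine sum_congr rfl fun i _ => ?_
        rw [← hfib i, ← smul_eq_mul, ← sum_const, hfib i]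
        refine sum_congr rfl fun u hu => ?_
        rw [hdeg, (mem_filter.1 hu).2]
    _ = ∑ u, deg H u := sum_fiberwise _ _ _
    _ = 2 * edgeCount H := sum_deg_eq_two_mul_edgeCount H
    _ ≤ 2 * turanEdges r n := by gcongr

theorem sum_mul_le_sum_mul_of_le_of_ne {ι : Type*} [Fintype ι] (l : ι) (d a k : ι → ℕ)
    (hd : ∀ i, d l ≤ d i) (ha : ∀ i, i ≠ l → a i ≤ k i) (hs : ∑ i, a i = ∑ i, k i) :
    ∑ i, a i * d i ≤ ∑ i, k i * d i := by
  have hsplit (b : ι → ℕ) : ∑ i, b i * d i = ∑ i, b i * (d i - d l) + (∑ i, b i) * d l := by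
    rw [sum_mul, ← sum_add_distrib]
    refine sum_congr rfl fun i _ => ?_
    rw [← mul_add, Nat.sub_add_cancel (hd i)]
  rw [hsplit, hsplit, hs]
  gcongr ?_ + _
  refine sum_le_sum fun i _ => ?_
  rcases eq_or_ne i l with rfl | h
  · simp
  · exact Nat.mul_le_mul_right _ (ha i h)

/-- Every vertex lies in the common neighbourhood of some initial segment of `v`, which is
either everything before the last term or ends at a non-neighbour. -/
theorem exists_adj_lt_and_not_adj_or_eq_last {V : Type*} (G : SimpleGraph V) {s : ℕ}
    (v : Fin (s + 1) → V) (u : V) :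
    ∃ i, (∀ j < i, G.Adj (v j) u) ∧ (i ≠ Fin.last s → ¬ G.Adj (v i) u) := by
  classical
  by_cases h : ∃ i, ¬ G.Adj (v i) u
  · obtain ⟨i, hi, hmin⟩ := WellFounded.has_min (wellFounded_lt (α := Fin (s + 1)))
      {i | ¬ G.Adj (v i) u} h
    exact ⟨i, fun j hj => by_contra fun hn => hmin j hn hj, fun _ => hi⟩
  · push Not at h
    exact ⟨Fin.last s, fun j _ => h j, fun hne => absurd rfl hne⟩

theorem edgeCount_le_turanEdges_of_isPSeq {s n : ℕ} (G : SimpleGraph (Fin n))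
    (v : Fin (s + 1) → Fin n) (hP : IsPSeq G v) (heq : ∑ i, deg G (v i) = s * n) :
    edgeCount G ≤ turanEdges (s + 1) n := by
  classical
  choose c hc hcn using exists_adj_lt_and_not_adj_or_eq_last G v
  have hdn (u : Fin n) : deg G u ≤ n := by
    rw [deg_eq_degree]
    simpa using (G.degree_lt_card_verts u).le
  let k (i : Fin (s + 1)) : ℕ := n - deg G (v i)
  have hkn (i : Fin (s + 1)) : n - k i = deg G (v i) := Nat.sub_sub_self (hdn _)
  have hksum : ∑ i, k i = n := by
    have h : ∑ i, k i + ∑ i, deg G (v i) = (s + 1) * n := by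
      rw [← sum_add_distrib]
      simp [k, Nat.sub_add_cancel (hdn _)]
    linarith
  have hfib (i : Fin (s + 1)) (hi : i ≠ Fin.last s) : #{u | c u = i} ≤ k i := by
    have h : ({u | c u = i} : Finset (Fin n)) ⊆ (G.neighborFinset (v i))ᶜ := by
      intro u hu
      obtain rfl : c u = i := by simpa using hu
      simpa using hcn u hi
    simpa [card_compl, k, deg_eq_degree] using card_le_card h
  have hlast (i : Fin (s + 1)) : deg G (v (Fin.last s)) ≤ deg G (v i) := by
    rcases (Fin.le_last i).eq_or_lt with rfl | hi
    · rfl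
    · exact (hP i).2 _ fun j hj => (hP (Fin.last s)).1 j (hj.trans hi)
  have hfibsum : ∑ i, #{u | c u = i} = ∑ i, k i := by
    rw [hksum, ← card_eq_sum_card_fiberwise (s := univ) (t := univ) (by simp), card_univ,
      Fintype.card_fin]
  refine Nat.le_of_mul_le_mul_left ?_ two_pos
  calc 2 * edgeCount G = ∑ u, deg G u := (sum_deg_eq_two_mul_edgeCount G).symm
    _ ≤ ∑ u, deg G (v (c u)) := sum_le_sum fun u _ => (hP (c u)).2 u (hc u)
    _ = ∑ i, #{u | c u = i} * deg G (v i) := by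
        rw [← sum_fiberwise univ c]
        refine sum_congr rfl fun i _ => ?_
        rw [← smul_eq_mul, ← sum_const]
        exact sum_congr rfl fun u hu => by rw [(mem_filter.1 hu).2]
    _ ≤ ∑ i, k i * deg G (v i) := sum_mul_le_sum_mul_of_le_of_ne _ _ _ _ hlast hfib hfibsum
    _ = ∑ i, k i * (n - k i) := by simp_rw [hkn]
    _ ≤ 2 * turanEdges (s + 1) n := sum_mul_sub_le_two_mul_turanEdges s.succ_pos k hksum

/-- If r ≥ 2, n ≥ r, G is a graph with n vertices and m ≥ t_r(n) edges,
and some 𝔓-sequence of r terms has degree sum exactly (r−1)·n, then m = t_r(n). -/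
theorem pseq_degree_sum_eq (r n m : ℕ) (hr : 2 ≤ r) (hn : r ≤ n)
    (G : SimpleGraph (Fin n)) (hm : edgeCount G = m) (hmt : turanEdges r n ≤ m)
    (v : Fin r → Fin n) (hP : IsPSeq G v)
    (heq : ∑ i, deg G (v i) = (r - 1) * n) :
    m = turanEdges r n := by
  obtain ⟨s, rfl⟩ : ∃ s, r = s + 1 := ⟨r - 1, by omega⟩
  exact le_antisymm (hm ▸ edgeCount_le_turanEdges_of_isPSeq G v hP heq) hmt
end

section
/- Let r ≥ 2 and n ≥ r be integers, and let G be a simple graph with n vertices and m edges, where m > t_r(n). Then every 𝔓-sequence v_1, …, v_r of r terms in G satisfies Σ_{i=1}^{r} d(v_i) > (r−1)·n. -/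
open Finset

/-- Summing a function over the top set of a decreasing chain, layer by layer, when the values on
the `i`-th set are at most `d i` and the `i`-th layer has at most `a i` elements. -/
lemma sum_le_sum_layers {V : Type*} [DecidableEq V] (S : ℕ → Finset V) (f : V → ℕ)
    (d a : ℕ → ℕ) (k : ℕ) (hS : ∀ i, S (i + 1) ⊆ S i)
    (hf : ∀ i ≤ k, ∀ u ∈ S i, f u ≤ d i) (hd : ∀ i < k, d (i + 1) ≤ d i)
    (ha : ∀ i ≤ k, #(S i) ≤ #(S (i + 1)) + a i) :
    ∑ u ∈ S 0, f u ≤ ∑ j ∈ range k,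
      ((#(S 0) - ∑ l ∈ range j, a l) - (#(S 0) - ∑ l ∈ range (j + 1), a l)) * d j
        + (#(S 0) - ∑ l ∈ range k, a l) * d k := by
  have hcard : ∀ i ≤ k, #(S 0) - ∑ l ∈ range i, a l ≤ #(S i) := by
    intro i
    induction i with
    | zero => simp
    | succ i ih =>
      intro hi
      have h1 := ih (by omega)
      have h2 := ha i (by omega)
      rw [sum_range_succ]
      omega
  have key : ∀ i ≤ k, ∑ u ∈ S 0, f u + #(S i) * d i ≤ ∑ j ∈ range i,
      ((#(S 0) - ∑ l ∈ range j, a l) - (#(S 0) - ∑ l ∈ range (j + 1), a l)) * d j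
        + (#(S 0) - ∑ l ∈ range i, a l) * d i + ∑ u ∈ S i, f u := by
    intro i
    induction i with
    | zero => simp [add_comm]
    | succ i ih =>
      intro hi
      have h1 := ih (by omega)
      have h2 : ∑ u ∈ S i, f u ≤ ∑ u ∈ S (i + 1), f u + #(S i \ S (i + 1)) * d i := by
        rw [← sum_sdiff (hS i), add_comm]
        gcongr
        exact sum_le_card_nsmul _ _ _ fun u hu =>
          hf i (by omega) u (mem_sdiff.1 hu).1
      have h3 := card_sdiff_add_card_eq_card (hS i)
      have h4 := hcard (i + 1) hi
      have h5 := hd i (by omega)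
      rw [sum_range_succ (n := i)]
      have h6 : #(S 0) - ∑ l ∈ range (i + 1), a l ≤ #(S 0) - ∑ l ∈ range i, a l := by
        rw [sum_range_succ]
        omega
      generalize #(S 0) - ∑ l ∈ range (i + 1), a l = q at *
      generalize #(S 0) - ∑ l ∈ range i, a l = p at *
      obtain ⟨b, rfl⟩ := Nat.exists_eq_add_of_le h6
      obtain ⟨e, he⟩ := Nat.exists_eq_add_of_le h5
      obtain ⟨c, hc⟩ := Nat.exists_eq_add_of_le h4
      rw [Nat.add_sub_cancel_left]
      rw [← h3, hc, he] at h1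
      rw [he] at h2
      rw [hc, he]
      nlinarith [Nat.zero_le (c * e)]
  have h1 := key k le_rfl
  have h2 : ∑ u ∈ S k, f u ≤ #(S k) * d k :=
    sum_le_card_nsmul _ _ _ fun u hu => hf k le_rfl u hu
  omega

lemma two_mul_card_edgeFinset_turanGraph (q r s : ℕ) (hs : s < r) :
    2 * #(SimpleGraph.turanGraph (q * r + s) r).edgeFinset + (r * q ^ 2 + 2 * q * s + s)
      = (q * r + s) ^ 2 := by
  rw [SimpleGraph.card_edgeFinset_turanGraph]
  have hmod : (q * r + s) % r = s := by
    rw [Nat.add_mod, Nat.mul_mod_left, zero_add, Nat.mod_mod, Nat.mod_eq_of_lt hs]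
  rw [hmod]
  obtain ⟨p, rfl⟩ : ∃ p, r = p + 1 := ⟨r - 1, by omega⟩
  obtain ⟨c, hc⟩ : Even (p * (p + 1)) := Nat.even_mul_succ_self p
  have h1 : ((q * (p + 1) + s) ^ 2 - s ^ 2) * (p + 1 - 1) / (2 * (p + 1))
      = q ^ 2 * c + q * s * p := by
    have h : (q * (p + 1) + s) ^ 2 - s ^ 2 = (q * (p + 1)) ^ 2 + 2 * (q * (p + 1)) * s := by
      rw [Nat.sub_eq_iff_eq_add (by gcongr; omega)]
      ring
    rw [h, Nat.add_sub_cancel]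
    apply Nat.div_eq_of_eq_mul_left (by positivity)
    linear_combination q ^ 2 * (p + 1) * hc
  have h2 : 2 * s.choose 2 + s = s ^ 2 := by
    rw [Nat.choose_two_right, Nat.two_mul_div_two_of_even (Nat.even_mul_pred_self s)]
    cases s with
    | zero => rfl
    | succ t => simp; ring
  rw [h1]
  linear_combination h2 - q ^ 2 * hc

/-- A complete multipartite graph with parts of sizes `b 0, …, b (r - 1)` has at most as many edges
as the Turán graph. -/
lemma sum_mul_sub_le_two_mul_turanEdges_s6 (r n : ℕ) (hr : 0 < r) (b d : ℕ → ℕ)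
    (hb : ∑ i ∈ range r, b i = n) (hd : ∀ i < r, b i + d i ≤ n) :
    ∑ i ∈ range r, b i * d i ≤ 2 * turanEdges r n := by
  have hT : turanEdges r n = #(SimpleGraph.turanGraph n r).edgeFinset := by
    rw [turanEdges, edgeCount, Nat.card_eq_fintype_card, SimpleGraph.edgeFinset_card]
  have h := two_mul_card_edgeFinset_turanGraph (n / r) r (n % r) (Nat.mod_lt _ hr)
  have hn : n / r * r + n % r = n := Nat.div_add_mod' n r
  rw [hn] at h
  rw [hT]
  generalize #(SimpleGraph.turanGraph n r).edgeFinset = t at *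
  generalize n / r = q at *
  generalize n % r = s at *
  have h1 : ∑ i ∈ range r, b i * d i + ∑ i ∈ range r, b i ^ 2 ≤ n * n := by
    rw [← sum_add_distrib]
    calc _ ≤ ∑ i ∈ range r, b i * n := sum_le_sum fun i hi => by
            have := hd i (mem_range.1 hi)
            calc _ = b i * (b i + d i) := by ring
              _ ≤ _ := by gcongr
      _ = n * n := by rw [← sum_mul, hb]
  have h2 : (2 * q + 1) * n ≤ ∑ i ∈ range r, b i ^ 2 + r * (q * (q + 1)) := by
    rw [← hb, mul_sum, ← smul_eq_mul r, ← card_range r, ← sum_const, card_range,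
      ← sum_add_distrib]
    refine sum_le_sum fun i _ => ?_
    rcases le_or_gt (b i) q with hle | hlt
    · obtain ⟨c, rfl⟩ := Nat.exists_eq_add_of_le hle
      nlinarith
    · obtain ⟨c, hc⟩ := Nat.exists_eq_add_of_le (Nat.succ_le_of_lt hlt)
      rw [hc]
      simp only [Nat.succ_eq_add_one]
      nlinarith
  nlinarith

/-- If r ≥ 2, n ≥ r, and G is a graph with n vertices and m > t_r(n)
edges, then every 𝔓-sequence of r terms has degree sum greater than (r−1)·n. -/
theorem pseq_degree_sum_gt (r n m : ℕ) (hr : 2 ≤ r) (hn : r ≤ n)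
    (G : SimpleGraph (Fin n)) (hm : edgeCount G = m) (hmt : turanEdges r n < m)
    (v : Fin r → Fin n) (hP : IsPSeq G v) :
    (r - 1) * n < ∑ i, deg G (v i) := by
  classical
  by_contra! hle
  have hdeg (u : Fin n) : deg G u = G.degree u := by
    rw [deg, Nat.card_eq_fintype_card, SimpleGraph.card_neighborSet_eq_degree]
  have hlt (u : Fin n) : deg G u ≤ n := by
    simpa [hdeg] using (G.degree_lt_card_verts u).le
  have hedge : ∑ u, deg G u = 2 * m := by
    simp_rw [hdeg]
    rw [SimpleGraph.sum_degrees_eq_twice_card_edges, ← hm, edgeCount, Nat.card_eq_fintype_card,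
      SimpleGraph.edgeFinset_card]
  obtain ⟨k, rfl⟩ : ∃ k, r = k + 1 := ⟨r - 1, by omega⟩
  obtain ⟨w, hw⟩ : ∃ w : ℕ → Fin n, ∀ i : Fin (k + 1), w i = v i :=
    ⟨fun i => v (Fin.ofNat (k + 1) i), fun i => by simp⟩
  let S : ℕ → Finset (Fin n) := fun i => {u | ∀ j < i, G.Adj (w j) u}
  have hmax : ∀ i ≤ k, ∀ u ∈ S i, deg G u ≤ deg G (w i) := by
    intro i hi u hu
    have := (hP ⟨i, by omega⟩).2 u fun j hj => by
      rw [← hw]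
      exact (mem_filter.1 hu).2 j hj
    rwa [← hw] at this
  have hmem : ∀ i ≤ k, w i ∈ S i := by
    intro i hi
    refine mem_filter.2 ⟨mem_univ _, fun j hj => ?_⟩
    have := (hP ⟨i, by omega⟩).1 ⟨j, by omega⟩ hj
    rwa [← hw, ← hw] at this
  have hS : ∀ i, S (i + 1) ⊆ S i := fun i u hu =>
    mem_filter.2 ⟨mem_univ _, fun j hj => (mem_filter.1 hu).2 j (by omega)⟩
  have hlayer : ∀ i ≤ k, #(S i) ≤ #(S (i + 1)) + (n - deg G (w i)) := by
    intro i _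
    have h1 : S i ⊆ S (i + 1) ∪ (G.neighborFinset (w i))ᶜ := by
      intro u hu
      by_cases h : G.Adj (w i) u
      · refine mem_union_left _ (mem_filter.2 ⟨mem_univ _, fun j hj => ?_⟩)
        rcases Nat.lt_succ_iff_lt_or_eq.1 hj with hj | rfl
        · exact (mem_filter.1 hu).2 j hj
        · exact h
      · exact mem_union_right _ (by simpa using h)
    refine (card_le_card h1).trans ((card_union_le _ _).trans ?_)
    rw [card_compl, Fintype.card_fin, SimpleGraph.card_neighborFinset_eq_degree, hdeg]
  have hsum := sum_le_sum_layers S (deg G) (fun i => deg G (w i)) (fun i => n - deg G (w i)) k hS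
    hmax (fun i hi => hmax i (by omega) _ (hS i (hmem (i + 1) (by omega)))) hlayer
  have hS0 : S 0 = univ := by simp [S]
  rw [hS0, hedge, card_univ, Fintype.card_fin] at hsum
  let R : ℕ → ℕ := fun i => n - ∑ l ∈ range i, (n - deg G (w l))
  have hsucc (i : ℕ) : R (i + 1) = R i - (n - deg G (w i)) := by
    simp only [R, sum_range_succ]
    omega
  have hlast : R (k + 1) = 0 := by
    have h1 : ∑ l ∈ range (k + 1), deg G (w l) ≤ k * n := by
      rw [← Fin.sum_univ_eq_sum_range (fun l => deg G (w l))]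
      simpa [hw] using hle
    have h2 : ∑ l ∈ range (k + 1), (n - deg G (w l)) + ∑ l ∈ range (k + 1), deg G (w l)
        = (k + 1) * n := by
      rw [← sum_add_distrib, sum_congr rfl fun l _ => Nat.sub_add_cancel (hlt (w l))]
      simp
    rw [add_mul] at h2
    simp only [R]
    omega
  have htel : ∑ i ∈ range (k + 1), (R i - R (i + 1)) = n := by
    have h (i : ℕ) : ∑ j ∈ range i, (R j - R (j + 1)) + R i = n := by
      induction i with
      | zero => simp [R]
      | succ i ih =>
        rw [sum_range_succ]
        have := hsucc i
        omega
    simpa [hlast] using h (k + 1)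
  have hbound := sum_mul_sub_le_two_mul_turanEdges_s6 (k + 1) n (by omega)
    (fun i => R i - R (i + 1)) (fun i => deg G (w i)) htel fun i _ => by
      have := hlt (w i)
      have := hsucc i
      omega
  rw [sum_range_succ, hlast, Nat.sub_zero] at hbound
  have := hsum.trans hbound
  omega
end

section
/- Let r ≥ 2 and n ≥ r be integers, and let G be a simple graph with n vertices and m edges such that m ≥ t_r(n) and G is not regular (not all vertex degrees are equal). Then there exists a 𝔓-sequence v_1, …, v_r of r terms in G with Σ_{i=1}^{r} d(v_i) > 2·r·m/n. -/
open Finset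

open SimpleGraph in
theorem two_mul_turanEdges (r n : ℕ) (hr : 0 < r) :
    (2 * turanEdges r n : ℤ) =
      n ^ 2 - (2 * (n / r : ℕ) + 1) * n + r * ((n / r : ℕ) * ((n / r : ℕ) + 1)) := by
  have hE : turanEdges r n =
      (n ^ 2 - (n % r) ^ 2) * (r - 1) / (2 * r) + (n % r).choose 2 := by
    rw [← card_edgeFinset_turanGraph, turanEdges, edgeCount, Nat.card_eq_fintype_card,
      ← edgeFinset_card]
  obtain ⟨s, rfl⟩ : ∃ s, r = s + 1 := ⟨r - 1, by omega⟩
  set q := n / (s + 1)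
  set b := n % (s + 1)
  have hn : n = (s + 1) * q + b := (Nat.div_add_mod n (s + 1)).symm
  obtain ⟨t, ht⟩ : 2 ∣ s * (s + 1) := (Nat.even_mul_succ_self s).two_dvd
  have hdiv : (n ^ 2 - b ^ 2) * (s + 1 - 1) / (2 * (s + 1)) = t * q ^ 2 + s * q * b := by
    have hsq : n ^ 2 - b ^ 2 = (s + 1) * ((s + 1) * q ^ 2 + 2 * q * b) := by
      rw [hn]
      exact Nat.sub_eq_of_eq_add (by ring)
    rw [hsq]
    apply Nat.div_eq_of_eq_mul_left (by positivity)
    simp only [Nat.add_sub_cancel]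
    linear_combination (s + 1) * q ^ 2 * ht
  have hb : (2 * b.choose 2 : ℤ) = b * (b - 1) := by
    rw [Nat.choose_two_right]
    have h := Nat.div_mul_cancel (Nat.even_mul_pred_self b).two_dvd
    rcases b.eq_zero_or_pos with h0 | h0
    · simp [h0]
    · have h1 : ((b - 1 : ℕ) : ℤ) = b - 1 := by omega
      rw [← h1]
      exact_mod_cast (mul_comm _ _).trans h
  have ht' : (s * (s + 1) : ℤ) = 2 * t := by exact_mod_cast ht
  have hn' : (n : ℤ) = (s + 1) * q + b := by exact_mod_cast hn
  rw [hE, hdiv, hn']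
  push_cast
  linear_combination hb - q ^ 2 * ht'

section Degrees

variable {n : ℕ} (G : SimpleGraph (Fin n))

theorem sum_deg : ∑ u, (deg G u : ℤ) = 2 * edgeCount G := by
  classical
  have h := G.sum_degrees_eq_twice_card_edges
  rw [edgeCount, Nat.card_eq_fintype_card, ← SimpleGraph.edgeFinset_card]
  have hd : ∀ u, deg G u = G.degree u := fun u => by
    rw [deg, Nat.card_eq_fintype_card, SimpleGraph.card_neighborSet_eq_degree]
  simp_rw [hd]
  exact_mod_cast h

open Classical in
theorem sum_not_adj (v : Fin n) :
    ∑ u, (if G.Adj v u then (0 : ℤ) else 1) = n - deg G v := by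
  have hd : deg G v = #{u | G.Adj v u} := by
    rw [deg, Nat.card_eq_fintype_card, SimpleGraph.card_neighborSet_eq_degree,
      ← SimpleGraph.card_neighborFinset_eq_degree, SimpleGraph.neighborFinset_eq_filter]
  have h : ∀ u, (if G.Adj v u then (0 : ℤ) else 1) = 1 - if G.Adj v u then 1 else 0 :=
    fun u => by split_ifs <;> simp
  simp_rw [h, sum_sub_distrib, hd, card_filter]
  simp

variable {G}

theorem two_mul_edgeCount_lt {v : Fin n} (hmax : ∀ u, deg G u ≤ deg G v)
    (hirr : ∃ u w : Fin n, deg G u ≠ deg G w) : (2 * edgeCount G : ℤ) < n * deg G v := by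
  obtain ⟨w, hw⟩ : ∃ w, deg G w < deg G v := by
    by_contra! h
    obtain ⟨u, w, huw⟩ := hirr
    exact huw (((hmax u).antisymm (h u)).trans ((hmax w).antisymm (h w)).symm)
  rw [← sum_deg]
  calc ∑ u, (deg G u : ℤ) < ∑ _u : Fin n, (deg G v : ℤ) :=
        sum_lt_sum (fun u _ => by exact_mod_cast hmax u) ⟨w, mem_univ w, by exact_mod_cast hw⟩
    _ = n * deg G v := by simp

/-- If the common neighbourhood is empty, the non-neighbourhoods cover all vertices. -/
theorem le_sum_of_no_common_neighbour {k : ℕ} {v : Fin k → Fin n}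
    (h : ∀ u, ∃ j, ¬ G.Adj (v j) u) : (n : ℤ) ≤ ∑ i, ((n : ℤ) - deg G (v i)) := by
  classical
  simp_rw [← sum_not_adj]
  rw [sum_comm]
  calc (n : ℤ) = ∑ _u : Fin n, (1 : ℤ) := by simp
    _ ≤ _ := sum_le_sum fun u _ => by
      obtain ⟨j, hj⟩ := h u
      have := single_le_sum (f := fun j => if G.Adj (v j) u then (0 : ℤ) else 1)
        (fun i _ => by split_ifs <;> simp) (mem_univ j)
      simpa [hj] using this

end Degrees

namespace IsPSeq

variable {V : Type*} {G : SimpleGraph V} {k : ℕ}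

theorem castSucc {v : Fin (k + 1) → V} (hv : IsPSeq G v) :
    IsPSeq G fun i : Fin k => v i.castSucc := fun i =>
  ⟨fun j hj => (hv i.castSucc).1 j.castSucc hj, fun u hu => (hv i.castSucc).2 u fun j hj => by
    have hjk : (j : ℕ) < k := lt_trans hj i.2
    exact hu ⟨j, hjk⟩ hj⟩

theorem snoc {v : Fin k → V} (hv : IsPSeq G v) {w : V} (hw : ∀ j, G.Adj (v j) w)
    (hmax : ∀ u, (∀ j, G.Adj (v j) u) → deg G u ≤ deg G w) :
    IsPSeq G (Fin.snoc v w : Fin (k + 1) → V) := by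
  intro i
  induction i using Fin.lastCases with
  | last =>
    refine ⟨fun j hj => ?_, fun u hu => ?_⟩
    · induction j using Fin.lastCases with
      | last => exact absurd hj (lt_irrefl _)
      | cast j => simpa using hw j
    · simpa using hmax u fun j => by simpa using hu j.castSucc (Fin.castSucc_lt_last j)
  | cast i =>
    refine ⟨fun j hj => ?_, fun u hu => ?_⟩
    · induction j using Fin.lastCases with
      | last => exact absurd hj (not_lt.2 (Fin.le_last _))
      | cast j => simpa using (hv i).1 j hj
    · simpa using (hv i).2 u fun j hj => by simpa using hu j.castSucc hj

theorem deg_last_le {v : Fin (k + 1) → V} (hv : IsPSeq G v) (i : Fin k) :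
    deg G (v (Fin.last k)) ≤ deg G (v i.castSucc) :=
  (hv i.castSucc).2 _ fun j hj => (hv (Fin.last k)).1 j (hj.trans (Fin.castSucc_lt_last i))

open Classical in
theorem deg_le {v : Fin (k + 1) → V} (hv : IsPSeq G v) (u : V) :
    (deg G u : ℤ) ≤ deg G (v (Fin.last k)) + ∑ i : Fin k,
      (if G.Adj (v i.castSucc) u then (0 : ℤ) else 1) *
        (deg G (v i.castSucc) - deg G (v (Fin.last k))) := by
  have hnn : ∀ i ∈ (univ : Finset (Fin k)), 0 ≤
      (if G.Adj (v i.castSucc) u then (0 : ℤ) else 1) *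
        (deg G (v i.castSucc) - deg G (v (Fin.last k))) := fun i _ => by
    have := hv.deg_last_le i
    split_ifs <;> simp; omega
  by_cases h : ∃ i : Fin (k + 1), i < Fin.last k ∧ ¬ G.Adj (v i) u
  · obtain ⟨i, ⟨hi, hiu⟩, hmin⟩ := exists_minimal_of_wellFoundedLT _ h
    have hle : deg G u ≤ deg G (v i) := (hv i).2 u fun j hj => by
      by_contra hju
      exact absurd (hmin ⟨hj.trans hi, hju⟩ hj.le) (not_le.2 hj)
    induction i using Fin.lastCases with
    | last => exact absurd hi (lt_irrefl _)
    | cast i =>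
      have := single_le_sum hnn (mem_univ i)
      simp only [hiu, if_false, one_mul] at this
      omega
  · push Not at h
    have := (hv (Fin.last k)).2 u h
    have := sum_nonneg hnn
    omega

/-- Each vertex has degree at most that of the first term it is not adjacent to; summing over
all vertices bounds the number of edges. -/
theorem two_mul_edgeCount_le {n : ℕ} {G : SimpleGraph (Fin n)} {v : Fin (k + 1) → Fin n}
    (hv : IsPSeq G v) :
    (2 * edgeCount G : ℤ) ≤ n * deg G (v (Fin.last k)) + ∑ i : Fin k,
      ((n : ℤ) - deg G (v i.castSucc)) * (deg G (v i.castSucc) - deg G (v (Fin.last k))) := by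
  classical
  rw [← sum_deg]
  refine (sum_le_sum fun u _ => hv.deg_le u).trans_eq ?_
  rw [sum_add_distrib, sum_comm]
  simp_rw [← sum_mul, sum_not_adj]
  simp

theorem eq_of_le_sum {r n : ℕ} (hr : 2 ≤ r) (hn : r ≤ n) {G : SimpleGraph (Fin n)}
    (hm : turanEdges r n ≤ edgeCount G) {v : Fin k → Fin n} (hv : IsPSeq G v) (hk : k ≤ r)
    (hsum : (n : ℤ) ≤ ∑ i, ((n : ℤ) - deg G (v i))) :
    k = r ∧ ∑ i, ((n : ℤ) - deg G (v i)) = n := by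
  induction k with
  | zero => simp at hsum; omega
  | succ k ih =>
    rw [Fin.sum_univ_castSucc] at hsum ⊢
    have hP : ∑ i : Fin k, ((n : ℤ) - deg G (v i.castSucc)) < n := by
      by_contra! h
      have := (ih hv.castSucc (by omega) h).1
      omega
    have hE := hv.two_mul_edgeCount_le
    have hT := two_mul_turanEdges r n (by omega)
    have hq : 1 ≤ n / r := (Nat.one_le_div_iff (by omega)).2 hn
    set q := n / r
    set c : Fin k → ℤ := fun i => (n : ℤ) - deg G (v i.castSucc) with hc
    set D : ℤ := ((deg G (v (Fin.last k)) : ℕ) : ℤ)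
    have hint : ∀ x : ℤ, 0 ≤ (x - q) * (x - q - 1) := fun x => by
      rcases le_or_gt x q with h | h
      · exact mul_nonneg_of_nonpos_of_nonpos (by omega) (by omega)
      · exact mul_nonneg (by omega) (by omega)
    have hE' : ∑ i : Fin k, ((n : ℤ) - deg G (v i.castSucc)) * (deg G (v i.castSucc) - D) =
        (n - D) * ∑ i, c i - ∑ i, c i ^ 2 := by
      rw [mul_sum, ← sum_sub_distrib]
      exact sum_congr rfl fun i _ => by simp only [hc]; ring
    have hS : 0 ≤ ∑ i, c i ^ 2 - (2 * q + 1) * ∑ i, c i + k * (q * (q + 1)) := by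
      have h := sum_nonneg fun i (_ : i ∈ (univ : Finset (Fin k))) => hint (c i)
      refine h.trans_eq ?_
      rw [mul_sum, ← sum_sub_distrib,
        show (k * (q * (q + 1)) : ℤ) = ∑ _i : Fin k, (q * (q + 1) : ℤ) by simp,
        ← sum_add_distrib]
      exact sum_congr rfl fun i _ => by ring
    change (n : ℤ) ≤ ∑ i, c i + _ at hsum
    change ∑ i, c i < (n : ℤ) at hP
    rw [hE'] at hE
    have hm' : (2 * turanEdges r n : ℤ) ≤ 2 * edgeCount G := by
      exact_mod_cast Nat.mul_le_mul_left 2 hm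
    set P := ∑ i, c i
    have he := hint (n - P)
    have key : ((r : ℤ) - k - 1) * (q * (q + 1)) + (n - P) * (P + (n - D) - n) ≤ 0 := by
      linarith
    have hq' : (0 : ℤ) < q * (q + 1) := by positivity
    have hkr : (0 : ℤ) ≤ (r : ℤ) - k - 1 := by omega
    have h1 := mul_nonneg hkr hq'.le
    have h2 : 0 ≤ (n - P) * (P + (n - D) - n) := mul_nonneg (by omega) (by omega)
    have h3 : ((r : ℤ) - k - 1) * (q * (q + 1)) = 0 := by omega
    have h4 : (n - P) * (P + (n - D) - n) = 0 := by omega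
    rcases mul_eq_zero.1 h3 with h3 | h3 <;> rcases mul_eq_zero.1 h4 with h4 | h4
    · omega
    · exact ⟨by omega, by change P + (n - D) = n; omega⟩
    all_goals omega

theorem exists_of_le {r n : ℕ} (hr : 2 ≤ r) (hn : r ≤ n) {G : SimpleGraph (Fin n)}
    (hm : turanEdges r n ≤ edgeCount G) (hk : k ≤ r) :
    ∃ v : Fin k → Fin n, IsPSeq G v := by
  classical
  induction k with
  | zero => exact ⟨Fin.elim0, fun i => i.elim0⟩
  | succ k ih =>
    obtain ⟨v, hv⟩ := ih (by omega)
    have hne : ({u | ∀ j, G.Adj (v j) u} : Finset (Fin n)).Nonempty := by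
      by_contra! h
      have := (hv.eq_of_le_sum hr hn hm (by omega) (le_sum_of_no_common_neighbour fun u => by
        by_contra! hu
        exact notMem_empty u (h ▸ mem_filter.2 ⟨mem_univ u, hu⟩))).1
      omega
    obtain ⟨w, hw, hmax⟩ := exists_max_image _ (deg G) hne
    exact ⟨_, hv.snoc (mem_filter.1 hw).2 fun u hu => hmax u (mem_filter.2 ⟨mem_univ u, hu⟩)⟩

end IsPSeq

/-- If r ≥ 2, n ≥ r, G is a graph with n vertices and m ≥ t_r(n) edges,
and G is not regular, then some 𝔓-sequence of r terms has degree sum > 2·r·m/n. -/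
theorem exists_pseq_degree_sum_gt_avg (r n m : ℕ) (hr : 2 ≤ r) (hn : r ≤ n)
    (G : SimpleGraph (Fin n)) (hm : edgeCount G = m) (hmt : turanEdges r n ≤ m)
    (hirr : ∃ u w : Fin n, deg G u ≠ deg G w) :
    ∃ v : Fin r → Fin n, IsPSeq G v ∧
      (2 * r * m : ℝ) / n < ∑ i, (deg G (v i) : ℝ) := by
  subst hm
  obtain ⟨v, hv⟩ := IsPSeq.exists_of_le hr hn hmt le_rfl
  refine ⟨v, hv, ?_⟩
  by_contra! hle
  have hs : ∑ i, ((n : ℤ) - deg G (v i)) ≤ n := by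
    by_contra! h
    exact absurd (hv.eq_of_le_sum hr hn hmt le_rfl h.le).2 h.ne'
  obtain ⟨k, rfl⟩ : ∃ k, r = k + 1 := ⟨r - 1, by omega⟩
  have hmax := two_mul_edgeCount_lt (v := v 0)
    (fun u => (hv 0).2 u fun j hj => absurd hj (Fin.not_lt_zero j)) hirr
  have hE := hv.two_mul_edgeCount_le
  have hn0 : (0 : ℝ) < n := by exact_mod_cast (by omega : 0 < n)
  rw [le_div_iff₀ hn0] at hle
  have hle' : (∑ i, (deg G (v i) : ℤ)) * n ≤ 2 * (k + 1) * edgeCount G := by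
    exact_mod_cast hle
  set D : ℤ := ((deg G (v (Fin.last k)) : ℕ) : ℤ)
  set y : Fin k → ℤ := fun i => deg G (v i.castSucc) - D with hy
  have hy0 : ∀ i, 0 ≤ y i := fun i => by
    have := hv.deg_last_le i
    simp only [hy]
    omega
  have hsum : ∑ i, (deg G (v i) : ℤ) = (k + 1) * D + ∑ i, y i := by
    rw [Fin.sum_univ_castSucc]
    simp only [hy, sum_sub_distrib, sum_const, card_univ, Fintype.card_fin, nsmul_eq_mul]
    ring
  have hE' : ∑ i : Fin k, ((n : ℤ) - deg G (v i.castSucc)) * (deg G (v i.castSucc) - D) =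
      (n - D) * ∑ i, y i - ∑ i, y i ^ 2 := by
    rw [mul_sum, ← sum_sub_distrib]
    exact sum_congr rfl fun i _ => by simp only [hy]; ring
  have hCS : (∑ i, y i) ^ 2 ≤ k * ∑ i, y i ^ 2 := by
    simpa using sq_sum_le_card_mul_sum_sq (s := univ) (f := y)
  have hY : 0 ≤ ∑ i, y i := sum_nonneg fun i _ => hy0 i
  rw [sum_sub_distrib, hsum] at hs
  simp only [sum_const, card_univ, Fintype.card_fin, nsmul_eq_mul] at hs
  push_cast at hs
  rw [hE'] at hE
  rw [hsum] at hle'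
  have hprod := mul_nonneg hY (sub_nonneg.2 hs)
  have hsq : ∑ i, y i ^ 2 ≤ 0 := by
    have := mul_le_mul_of_nonneg_left hE (by positivity : (0 : ℤ) ≤ k + 1)
    nlinarith
  have hzero : ∀ i, y i = 0 := fun i => by
    have h := (sum_eq_zero_iff_of_nonneg fun i _ => sq_nonneg (y i)).1
      (hsq.antisymm (sum_nonneg fun i _ => sq_nonneg (y i))) i (mem_univ i)
    exact pow_eq_zero_iff two_ne_zero |>.1 h
  have hD : (deg G (v 0) : ℤ) = D := by
    have h := hzero ⟨0, by omega⟩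
    exact sub_eq_zero.1 h
  simp only [hzero, sum_const_zero, add_zero] at hle'
  rw [hD] at hmax
  have := mul_lt_mul_of_pos_left hmax (by positivity : (0 : ℤ) < k + 1)
  linarith
end

section
/- Let r ≥ 2 and n ≥ r be integers, and let m be an integer with t_r(n) ≤ m ≤ n(n−1)/2. Then there exists a simple graph G with n vertices and m edges such that every r-clique R of G satisfies Σ_{u∈R} d(u) < 2·r·m/n + r. Consequently, Δ_r(n,m) < 2·r·m/n + r. -/
open Finset

/-- Δ_r(G): the maximum degree sum over r-cliques of G (0 if there is none). -/
noncomputable def DeltaG (r : ℕ) {V : Type*} (G : SimpleGraph V) : ℕ :=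
  sSup {s | ∃ R : Finset V, G.IsNClique r R ∧ s = ∑ u ∈ R, deg G u}

/-- Δ_r(n,m): the minimum of Δ_r(G) over all graphs with n vertices and m edges. -/
noncomputable def DeltaNM (r n m : ℕ) : ℕ :=
  sInf {s | ∃ G : SimpleGraph (Fin n), edgeCount G = m ∧ s = DeltaG r G}

theorem exists_edgeCount_eq (n m : ℕ) (hm : m ≤ n * (n - 1) / 2) :
    ∃ G : SimpleGraph (Fin n), edgeCount G = m := by
  classical
  have hcard : m ≤ #(⊤ : SimpleGraph (Fin n)).edgeFinset := by
    rwa [SimpleGraph.card_edgeFinset_top_eq_card_choose_two, Fintype.card_fin,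
      Nat.choose_two_right]
  obtain ⟨s, hs, rfl⟩ := exists_subset_card_eq hcard
  refine ⟨SimpleGraph.fromEdgeSet s, ?_⟩
  have h : (SimpleGraph.fromEdgeSet (s : Set (Sym2 (Fin n)))).edgeSet = s := by
    rw [SimpleGraph.edgeSet_fromEdgeSet, sdiff_eq_left, Set.disjoint_left]
    intro e he hd
    have := hs he
    rw [SimpleGraph.mem_edgeFinset] at this
    exact SimpleGraph.not_isDiag_of_mem_edgeSet _ this hd
  rw [edgeCount, h]
  simp

/-- Replacing the edge `uw` by the non-edge `vw` lowers the degree of `u` by one, raises that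
of `v` by one, and keeps all other degrees. -/
theorem exists_deg_switch {V : Type*} [Finite V] [DecidableEq V] (G : SimpleGraph V) {u v w : V}
    (huv : u ≠ v) (hwv : w ≠ v) (huw : G.Adj u w) (hvw : ¬ G.Adj v w) :
    ∃ H : SimpleGraph V, ∀ x,
      deg H x + (if x = u then 1 else 0) = deg G x + (if x = v then 1 else 0) := by
  classical
  have := Fintype.ofFinite V
  have hne := huw.ne
  have hwu := huw.symm
  have hwv' : ¬ G.Adj w v := fun h => hvw h.symm
  let H : SimpleGraph V := (G \ SimpleGraph.edge u w) ⊔ SimpleGraph.edge v w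
  have hadj (x y : V) : H.Adj x y ↔ (G.Adj x y ∧ ¬ (x = u ∧ y = w ∨ x = w ∧ y = u)) ∨
      (x = v ∧ y = w ∨ x = w ∧ y = v) := by
    simp only [H, SimpleGraph.sup_adj, SimpleGraph.sdiff_adj, SimpleGraph.edge_adj]
    grind [SimpleGraph.Adj.ne]
  refine ⟨H, fun x => ?_⟩
  rw [deg_eq_degree, deg_eq_degree, ← SimpleGraph.card_neighborFinset_eq_degree,
    ← SimpleGraph.card_neighborFinset_eq_degree]
  by_cases hxu : x = u
  · subst hxu
    have : H.neighborFinset x = (G.neighborFinset x).erase w := by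
      ext y
      simp only [SimpleGraph.mem_neighborFinset, mem_erase, hadj]
      grind
    rw [this, if_pos rfl, if_neg huv, card_erase_add_one (by simpa using huw), add_zero]
  by_cases hxv : x = v
  · subst hxv
    have : H.neighborFinset x = insert w (G.neighborFinset x) := by
      ext y
      simp only [SimpleGraph.mem_neighborFinset, mem_insert, hadj]
      grind
    rw [this, if_pos rfl, if_neg hxu, card_insert_of_notMem (by simpa using hvw), add_zero]
  rw [if_neg hxu, if_neg hxv, add_zero, add_zero]
  by_cases hxw : x = w
  · subst hxw
    have : H.neighborFinset x = insert v ((G.neighborFinset x).erase u) := by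
      ext y
      simp only [SimpleGraph.mem_neighborFinset, mem_insert, mem_erase, hadj]
      grind
    rw [this, card_insert_of_notMem (by simp [hwv']), card_erase_add_one (by simpa using hwu)]
  · congr 1
    ext y
    simp only [SimpleGraph.mem_neighborFinset, hadj]
    grind

theorem exists_adj_not_adj_of_deg_lt {V : Type*} [Finite V] (G : SimpleGraph V) {u v : V}
    (h : deg G v + 1 < deg G u) : ∃ w, w ≠ v ∧ G.Adj u w ∧ ¬ G.Adj v w := by
  classical
  have := Fintype.ofFinite V
  rw [deg_eq_degree, deg_eq_degree] at h
  by_contra! hc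
  have hsub : G.neighborFinset u ⊆ insert v (G.neighborFinset v) := by
    intro w hw
    rw [SimpleGraph.mem_neighborFinset] at hw
    rw [mem_insert, SimpleGraph.mem_neighborFinset]
    by_cases hwv : w = v
    · exact Or.inl hwv
    · exact Or.inr (hc w hwv hw)
  have := (card_le_card hsub).trans (card_insert_le _ _)
  simp only [SimpleGraph.card_neighborFinset_eq_degree] at this
  omega

theorem exists_edgeCount_eq_and_deg_le_deg_add_one (n m : ℕ) (hm : m ≤ n * (n - 1) / 2) :
    ∃ G : SimpleGraph (Fin n), edgeCount G = m ∧ ∀ u v, deg G u ≤ deg G v + 1 := by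
  obtain ⟨G, hG, hmin⟩ := Set.exists_min_image {G : SimpleGraph (Fin n) | edgeCount G = m}
    (fun G => ∑ x, (deg G x : ℤ) ^ 2) (Set.toFinite _) (exists_edgeCount_eq n m hm)
  refine ⟨G, hG, fun u v => ?_⟩
  by_contra! huv
  obtain ⟨w, hwv, huw, hvw⟩ := exists_adj_not_adj_of_deg_lt G huv
  have hne : u ≠ v := by rintro rfl; omega
  obtain ⟨H, hH⟩ := exists_deg_switch G hne hwv huw hvw
  have hcount : edgeCount H = m := by
    have hsum := Finset.sum_congr (rfl : (univ : Finset (Fin n)) = univ) fun x _ => hH x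
    simp only [sum_add_distrib, sum_ite_eq', mem_univ, if_true,
      sum_deg_eq_two_mul_edgeCount] at hsum
    rw [Set.mem_ofPred_eq] at hG
    omega
  have hsq (x : Fin n) : (deg H x : ℤ) ^ 2 = (deg G x : ℤ) ^ 2 +
      (if x = v then 2 * (deg G v : ℤ) + 1 else 0) +
      (if x = u then 1 - 2 * (deg G u : ℤ) else 0) := by
    have hx := hH x
    zify at hx
    have hx' : (deg H x : ℤ) = deg G x + (if x = v then 1 else 0) - (if x = u then 1 else 0) := by
      linarith
    rw [hx']
    by_cases hxu : x = u
    · subst hxu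
      simp only [if_neg hne, if_true]
      ring
    · by_cases hxv : x = v
      · subst hxv
        simp only [if_neg hxu, if_true]
        ring
      · simp [hxu, hxv]
  have hle := hmin H hcount
  simp only [hsq, sum_add_distrib, sum_ite_eq', mem_univ, if_true] at hle
  omega

theorem mul_deg_lt_of_deg_le_deg_add_one {V : Type*} [Fintype V] (G : SimpleGraph V)
    (h : ∀ u v, deg G u ≤ deg G v + 1) (u : V) :
    Fintype.card V * deg G u < 2 * edgeCount G + Fintype.card V := by
  have hlt : ∑ _v : V, deg G u < ∑ v : V, (deg G v + 1) :=
    sum_lt_sum (fun v _ => h u v) ⟨u, mem_univ u, Nat.lt_succ_self _⟩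
  simpa [sum_add_distrib, sum_deg_eq_two_mul_edgeCount] using hlt

theorem DeltaG_eq_zero_or_exists {V : Type*} [Finite V] (r : ℕ) (G : SimpleGraph V) :
    DeltaG r G = 0 ∨ ∃ R : Finset V, G.IsNClique r R ∧ DeltaG r G = ∑ u ∈ R, deg G u := by
  have hfin : {s | ∃ R : Finset V, G.IsNClique r R ∧ s = ∑ u ∈ R, deg G u}.Finite :=
    (Set.finite_range fun R : Finset V => ∑ u ∈ R, deg G u).subset
      fun _ ⟨R, _, hs⟩ => ⟨R, hs.symm⟩
  rcases Set.eq_empty_or_nonempty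
    {s | ∃ R : Finset V, G.IsNClique r R ∧ s = ∑ u ∈ R, deg G u} with h | h
  · left
    rw [DeltaG, h, csSup_empty, bot_eq_zero]
  · exact Or.inr (Nat.sSup_mem h hfin.bddAbove)

/-- For r ≥ 2, n ≥ r and t_r(n) ≤ m ≤ n(n−1)/2 there is a graph with
n vertices and m edges all of whose r-cliques have degree sum < 2·r·m/n + r;
consequently Δ_r(n,m) < 2·r·m/n + r. -/
theorem deltaNM_lt (r n m : ℕ) (hr : 2 ≤ r) (hn : r ≤ n)
    (hm1 : turanEdges r n ≤ m) (hm2 : m ≤ n * (n - 1) / 2) :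
    (∃ G : SimpleGraph (Fin n), edgeCount G = m ∧
      ∀ R : Finset (Fin n), G.IsNClique r R →
        (∑ u ∈ R, (deg G u : ℝ)) < 2 * r * m / n + r) ∧
    (DeltaNM r n m : ℝ) < 2 * r * m / n + r := by
  obtain ⟨G, hG, hdeg⟩ := exists_edgeCount_eq_and_deg_le_deg_add_one n m hm2
  have hn0 : (0 : ℝ) < n := by exact_mod_cast (by omega : 0 < n)
  have hlt (u : Fin n) : (deg G u : ℝ) < 2 * m / n + 1 := by
    have h := mul_deg_lt_of_deg_le_deg_add_one G hdeg u
    rw [hG, Fintype.card_fin] at h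
    have h' : (n : ℝ) * deg G u < 2 * m + n := by exact_mod_cast h
    rw [div_add_one hn0.ne', lt_div_iff₀ hn0]
    linarith
  have hclique (R : Finset (Fin n)) (hR : G.IsNClique r R) :
      (∑ u ∈ R, (deg G u : ℝ)) < 2 * r * m / n + r := by
    have hne : R.Nonempty := card_pos.mp (by rw [hR.card_eq]; omega)
    calc ∑ u ∈ R, (deg G u : ℝ) < ∑ _u ∈ R, (2 * (m : ℝ) / n + 1) :=
          sum_lt_sum_of_nonempty hne fun u _ => hlt u
      _ = 2 * r * m / n + r := by
          rw [sum_const, hR.card_eq, nsmul_eq_mul]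
          ring
  refine ⟨⟨G, hG, hclique⟩, ?_⟩
  have hle : DeltaNM r n m ≤ DeltaG r G := Nat.sInf_le ⟨G, hG, rfl⟩
  refine (Nat.cast_le.mpr hle).trans_lt ?_
  rcases DeltaG_eq_zero_or_exists r G with h | ⟨R, hR, h⟩
  · rw [h, Nat.cast_zero]
    positivity
  · rw [h, Nat.cast_sum]
    exact hclique R hR
end
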